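/- There exist no positive integers x, z, t, w such that 2x² + z² = t², x² + z² = w², and gcd(x, z) = 1. In other words, there exists no Pythagorean box with a square base (edge lengths x, x, z and integer inner diagonal t) possessing a face which is a primitive Pythagorean rectangle. -/

import Mathlib

/-- If the product of two coprime positive integers is a square, each of them is a square. -/
theorem sq_and_sq_of_mul_eq_sq {a b c : ℤ} (ha : 0 < a) (hb : 0 < b) (hab : IsCoprime a b)
    (h : a * b = c ^ 2) : (∃ r, a = r ^ 2) ∧ ∃ s, b = s ^ 2 := by
  constructor
  · obtain ⟨r, hr | hr⟩ := Int.sq_of_isCoprime hab h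
    · exact ⟨r, hr⟩
    · nlinarith [sq_nonneg r]
  · obtain ⟨s, hs | hs⟩ := Int.sq_of_isCoprime hab.symm (by rw [mul_comm, h])
    · exact ⟨s, hs⟩
    · nlinarith [sq_nonneg s]

/-- A primitive Pythagorean triple `(2 * p, q, w)` whose area `p * q` is a square yields
three coprime squares in arithmetic progression with small difference `b ^ 2`. -/
theorem exists_sq_progression_of_sq_area {p q w y : ℤ} (hp : 0 < p) (hq : 0 < q)
    (hpq : IsCoprime (2 * p) q) (hy : p * q = y ^ 2) (hw : (2 * p) ^ 2 + q ^ 2 = w ^ 2) :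
    ∃ b e a f : ℤ, b ≠ 0 ∧ b ^ 2 + e ^ 2 = a ^ 2 ∧ 2 * b ^ 2 + e ^ 2 = f ^ 2 ∧
      IsCoprime b e ∧ b ^ 2 ≤ p := by
  obtain ⟨⟨u, rfl⟩, v, rfl⟩ := sq_and_sq_of_mul_eq_sq hp hq hpq.of_mul_left_right hy
  have hodd : v ^ 2 % 2 = 1 := by
    have h2 : IsCoprime (2 : ℤ) (v ^ 2) := hpq.of_mul_left_left
    rcases Int.emod_two_eq_zero_or_one (v ^ 2) with h | h
    · have := h2.isUnit_of_dvd' dvd_rfl (Int.dvd_of_emod_eq_zero h)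
      norm_num [Int.isUnit_iff] at this
    · exact h
  have hw0 : 0 < |w| := by
    rw [abs_pos]
    rintro rfl
    nlinarith
  have htriple : PythagoreanTriple (v ^ 2) (2 * u ^ 2) |w| := by
    unfold PythagoreanTriple
    rw [abs_mul_abs_self]
    linear_combination hw
  obtain ⟨m, n, h1, h2, -, hmn, hpar, hm⟩ :=
    htriple.coprime_classification' (Int.isCoprime_iff_gcd_eq_one.mp hpq.symm) hodd hw0
  have hmul : m * n = u ^ 2 := by linarith
  have hm0 : 0 < m := by
    rcases hm.lt_or_eq with h | h
    · exact h
    · subst h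
      linarith
  have hn0 : 0 < n := pos_of_mul_pos_right (hmul ▸ hp) hm
  obtain ⟨⟨a, rfl⟩, b, rfl⟩ :=
    sq_and_sq_of_mul_eq_sq hm0 hn0 (Int.isCoprime_iff_gcd_eq_one.mpr hmn) hmul
  have hab : IsCoprime (a ^ 2) (b ^ 2) := Int.isCoprime_iff_gcd_eq_one.mpr hmn
  have hfac : (a ^ 2 + b ^ 2) * (a ^ 2 - b ^ 2) = v ^ 2 := by linarith
  have hsum : 0 < a ^ 2 + b ^ 2 := by linarith
  have hdiff : 0 < a ^ 2 - b ^ 2 := pos_of_mul_pos_right (hfac ▸ hq) hsum.le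
  have hdiffb : IsCoprime (b ^ 2) (a ^ 2 - b ^ 2) := by
    obtain ⟨r, s, hrs⟩ := hab
    exact ⟨r + s, r, by linear_combination hrs⟩
  have hcop : IsCoprime (a ^ 2 + b ^ 2) (a ^ 2 - b ^ 2) := by
    have h2 : IsCoprime (2 : ℤ) (a ^ 2 - b ^ 2) := by
      have : (a ^ 2 - b ^ 2) % 2 = 1 := by lia
      exact ⟨-((a ^ 2 - b ^ 2) / 2), 1, by lia⟩
    obtain ⟨r, s, hrs⟩ := h2.mul_left hdiffb
    exact ⟨r, s - r, by linear_combination hrs⟩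
  obtain ⟨⟨f, hf⟩, e, he⟩ := sq_and_sq_of_mul_eq_sq hsum hdiff hcop hfac
  refine ⟨b, e, a, f, ?_, by linarith, by linarith, ?_, by nlinarith⟩
  · rintro rfl
    simp at hn0
  · rw [he] at hdiffb
    exact (IsCoprime.pow_iff two_pos two_pos).mp hdiffb

/-- Three squares `z ^ 2`, `w ^ 2`, `t ^ 2` in arithmetic progression with difference `x ^ 2`,
where `x` and `z` are coprime, force `x = 0`. -/
theorem eq_zero_of_sq_progression {x z w t : ℤ} (hw : x ^ 2 + z ^ 2 = w ^ 2)
    (ht : 2 * x ^ 2 + z ^ 2 = t ^ 2) (hxz : IsCoprime x z) : x = 0 := by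
  induction hk : x.natAbs using Nat.strong_induction_on generalizing x z w t with
  | _ k ih =>
  by_contra hx
  wlog ht0 : 0 ≤ t generalizing t
  · exact this (t := -t) (by rw [ht, neg_sq]) (by linarith)
  have hpar : t % 2 = z % 2 := by
    have h : (2 * x ^ 2 + z ^ 2) % 2 = t ^ 2 % 2 := by rw [ht]
    rcases Int.emod_two_eq_zero_or_one t with h1 | h1 <;>
    rcases Int.emod_two_eq_zero_or_one z with h2 | h2 <;>
    simp [pow_two, Int.add_emod, Int.mul_emod, h1, h2] at h ⊢
  obtain ⟨p, q, rfl, rfl⟩ : ∃ p q, t = p + q ∧ z = p - q :=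
    ⟨(t + z) / 2, (t - z) / 2, by lia, by lia⟩
  have hpq : 2 * (p * q) = x ^ 2 := by linarith
  have hx2 : 0 < x ^ 2 := by positivity
  have hp : 0 < p := by
    by_contra! h
    nlinarith
  have hq : 0 < q := by
    by_contra! h
    nlinarith
  have hcop : IsCoprime p q := by
    have h : IsCoprime (x ^ 2) (p - q) := hxz.pow_left
    rw [← hpq] at h
    have h' := h.of_mul_left_right.of_mul_left_left
    obtain ⟨r, s, hrs⟩ := h'
    exact ⟨r + s, -s, by linear_combination hrs⟩
  obtain ⟨y, rfl⟩ : 2 ∣ x := Int.prime_two.dvd_of_dvd_pow (hpq ▸ dvd_mul_right _ _)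
  have descend {p' q' : ℤ} (hp' : 0 < p') (hq' : 0 < q') (h : IsCoprime (2 * p') q')
      (hy : p' * q' = y ^ 2) (hw' : (2 * p') ^ 2 + q' ^ 2 = w ^ 2) : False := by
    obtain ⟨b, e, a, f, hb, ha, hf, hbe, hle⟩ :=
      exists_sq_progression_of_sq_area hp' hq' h hy hw'
    refine hb (ih b.natAbs ?_ ha hf hbe rfl)
    rw [← hk, Int.natAbs_lt_iff_sq_lt]
    nlinarith
  have heven : 2 ∣ p * q := ⟨y ^ 2, by linarith⟩
  rcases Int.prime_two.dvd_or_dvd heven with ⟨p', rfl⟩ | ⟨q', rfl⟩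
  · exact descend (p' := p') (q' := q) (by linarith) hq hcop (by linarith) (by linarith)
  · exact descend (p' := q') (q' := p) (by linarith) hp hcop.symm (by linarith) (by linarith)

/-- Result 3: there is no Pythagorean box with a square base possessing a face
which is a primitive Pythagorean rectangle. -/
theorem no_square_base_box_with_primitive_face :
    ¬ ∃ x z t w : ℕ, 0 < x ∧ 0 < z ∧ 0 < t ∧ 0 < w ∧
      2 * x ^ 2 + z ^ 2 = t ^ 2 ∧ x ^ 2 + z ^ 2 = w ^ 2 ∧ Nat.gcd x z = 1 := by
  rintro ⟨x, z, t, w, hx, -, -, -, ht, hw, hxz⟩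
  have h := eq_zero_of_sq_progression (x := x) (z := z) (w := w) (t := t)
    (by exact_mod_cast hw) (by exact_mod_cast ht) (Nat.isCoprime_iff_coprime.mpr hxz)
  exact hx.ne' (by exact_mod_cast h)
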